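/- arXiv:2506.07817 — 3 statements merged into one kernel-verified Lean document; each statement's English description precedes it below -/
import Mathlib

section
/- Let q ≥ 2, b, t ≥ 1 and n ≥ bt+1. For every x ∈ Σ_q^n, equality |L_t^b(x)| = q^{t(b−1)} · Σ_{i=0}^{t} C(n−t(b−1), i) (q−1)^i holds if and only if |D_t^b(x)| = 1. -/
/-- `BurstDel b x y` : `y` is obtained from `x` by one burst of `b` deletions,
i.e. by deleting `b` consecutive entries. -/
def BurstDel {q : ℕ} (b : ℕ) (x y : List (Fin q)) : Prop :=
  ∃ i : ℕ, i + b ≤ x.length ∧ y = x.take i ++ x.drop (i + b)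

/-- `BurstIns b x y` : `y` is obtained from `x` by one burst of `b` insertions,
i.e. by inserting an arbitrary block of `b` consecutive entries. -/
def BurstIns {q : ℕ} (b : ℕ) (x y : List (Fin q)) : Prop :=
  ∃ (i : ℕ) (v : List (Fin q)), i ≤ x.length ∧ v.length = b ∧
    y = x.take i ++ v ++ x.drop i

/-- `relIter R t` : `t`-fold composition of the relation `R`. -/
def relIter {α : Type*} (R : α → α → Prop) : ℕ → α → α → Prop
  | 0 => Eq
  | t + 1 => fun x y => ∃ z, R x z ∧ relIter R t z y

/-- The `b`-burst-deletion ball of radius `t` centered at `x`. -/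
def delBall (q b t : ℕ) (x : List (Fin q)) : Set (List (Fin q)) :=
  {y | relIter (BurstDel b) t x y}

/-- The `b`-burst-insertion ball of radius `t` centered at `x`. -/
def insBall (q b t : ℕ) (x : List (Fin q)) : Set (List (Fin q)) :=
  {y | relIter (BurstIns b) t x y}

/-- The fixed-length `b`-burst Levenshtein ball of radius `t` centered at `x`:
`t` bursts of `b` deletions followed by `t` bursts of `b` insertions. -/
def levBall (q b t : ℕ) (x : List (Fin q)) : Set (List (Fin q)) :=
  {z | ∃ y ∈ delBall q b t x, z ∈ insBall q b t y}

/-- `rB q b x` : the number of `b`-runs of `x` (0-indexed version of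
`1 + |{i ∈ [1, n-b] : x_i ≠ x_{i+b}}|`). -/
def rB (q b : ℕ) (x : List (Fin q)) : ℕ :=
  1 + ((Finset.range (x.length - b)).filter fun i => x[i]? ≠ x[i + b]?).card

/-- `fB q b j x` : 0-indexed version of
`|{i ∈ [1, n-b-j] : x_i ≠ x_{i+b} ∧ x_{i+j} ≠ x_{i+j+b}}|`. -/
def fB (q b j : ℕ) (x : List (Fin q)) : ℕ :=
  ((Finset.range (x.length - b - j)).filter fun i =>
    x[i]? ≠ x[i + b]? ∧ x[i + j]? ≠ x[i + j + b]?).card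

/-- `gB q b i x` : 0-indexed version of
`|{j ∈ [i+b, n-b] : x_i ≠ x_{i+b}, x_j ≠ x_{j+b}, x_{[i,j+b]} is 2b-periodic}|`
(here `i` is a 0-based index, `i ∈ [0, n-2b-1]`). -/
def gB (q b i : ℕ) (x : List (Fin q)) : ℕ :=
  ((Finset.Icc (i + b) (x.length - b - 1)).filter fun j =>
    x[i]? ≠ x[i + b]? ∧ x[j]? ≠ x[j + b]? ∧
      ∀ t ∈ Finset.Icc i (j - b), x[t]? = x[t + 2 * b]?).card

/-- `GapEmb b t y z` : `z` arises from `y` by interspersing `t` blocks of length `b`,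
none of them nested in another. -/
inductive GapEmb {α : Type*} (b : ℕ) : ℕ → List α → List α → Prop
  | nil : GapEmb b 0 [] []
  | cons (a : α) {t : ℕ} {y z : List α} : GapEmb b t y z → GapEmb b t (a :: y) (a :: z)
  | gap (v : List α) {t : ℕ} {y z : List α} :
      v.length = b → GapEmb b t y z → GapEmb b (t + 1) y (v ++ z)

namespace GapEmb

variable {α : Type*} {b t : ℕ}

theorem refl (y : List α) : GapEmb b 0 y y := by
  induction y with
  | nil => exact .nil
  | cons a y ih => exact .cons a ih

theorem length_eq {y z : List α} (h : GapEmb b t y z) : z.length = y.length + t * b := by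
  induction h with
  | nil => simp
  | cons a _ ih => simp only [List.length_cons, ih]; ring
  | gap v hv _ ih => simp only [List.length_append, ih, hv]; ring

theorem eq_of_zero {y z : List α} (h : GapEmb b 0 y z) : z = y := by
  generalize hs : 0 = s at h
  induction h with
  | nil => rfl
  | cons a _ ih => rw [ih hs]
  | gap => omega

theorem insert {y z v : List α} (h : GapEmb b t y z) (hv : v.length = b) (i : ℕ) :
    GapEmb b (t + 1) y (z.take i ++ v ++ z.drop i) := by
  induction h generalizing i with
  | nil => simpa using GapEmb.gap v hv .nil
  | cons a h ih =>
    cases i with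
    | zero => simpa using GapEmb.gap v hv (.cons a h)
    | succ i => simpa using GapEmb.cons a (ih i)
  | @gap u t y z hu h ih =>
    rcases le_or_gt i b with hi | hi
    · have key : (u ++ z).take i ++ v ++ (u ++ z).drop i =
          (u.take i ++ v.take (b - i)) ++ ((v.drop (b - i) ++ u.drop i) ++ z) := by
        rw [List.take_append_of_le_length (by omega), List.drop_append_of_le_length (by omega)]
        conv_lhs => rw [← List.take_append_drop (b - i) v]
        simp only [List.append_assoc]
      rw [key]
      refine .gap _ ?_ (.gap _ ?_ h) <;>
        simp only [List.length_append, List.length_take, List.length_drop] <;> omega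
    · obtain ⟨j, rfl⟩ := Nat.exists_eq_add_of_lt hi
      have key : (u ++ z).take (b + j + 1) ++ v ++ (u ++ z).drop (b + j + 1) =
          u ++ (z.take (j + 1) ++ v ++ z.drop (j + 1)) := by
        rw [add_assoc, ← hu, List.take_length_add_append, List.drop_length_add_append]
        simp only [List.append_assoc]
      rw [key]
      exact .gap u hu (ih (j + 1))

theorem absorb_head (hb : 1 ≤ b) {a : α} {y z v : List α} (h : GapEmb b t (a :: y) z)
    (hv : v.length + 1 = b) : GapEmb b (t + 1) y (v ++ z) := by
  generalize hs : a :: y = s at h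
  induction h generalizing v with
  | nil => simp at hs
  | @cons c t y' z h ih =>
    obtain ⟨rfl, rfl⟩ := List.cons.inj hs
    simpa using GapEmb.gap (v ++ [a]) (by simpa using hv) h
  | gap w hw h ih =>
    cases w with
    | nil => simp at hw; omega
    | cons c w =>
      simpa using GapEmb.gap (v ++ [c]) (by simpa using hv) (ih (v := w) (by simpa using hw) hs)

theorem cons_self_iff (hb : 1 ≤ b) {a : α} {y z : List α} :
    GapEmb b t (a :: y) (a :: z) ↔ GapEmb b t y z := by
  refine ⟨fun h => ?_, .cons a⟩
  generalize hs : a :: z = s at h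
  cases h with
  | cons a h => obtain ⟨-, rfl⟩ := List.cons.inj hs; exact h
  | gap v hv h =>
    cases v with
    | nil => simp at hv; omega
    | cons c v =>
      obtain ⟨rfl, rfl⟩ := List.cons.inj hs
      exact h.absorb_head hb (by simpa using hv)

theorem exists_of_ne (hb : 1 ≤ b) {a c : α} (hac : c ≠ a) {y z : List α}
    (h : GapEmb b t (a :: y) (c :: z)) :
    ∃ s v w, t = s + 1 ∧ v.length = b - 1 ∧ z = v ++ w ∧ GapEmb b s (a :: y) w := by
  generalize hs : c :: z = s at h
  cases h with
  | cons a h => exact absurd (List.cons.inj hs).1 hac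
  | @gap v s _ w hv h =>
    cases v with
    | nil => simp at hv; omega
    | cons d v =>
      obtain ⟨rfl, rfl⟩ := List.cons.inj hs
      exact ⟨s, v, w, rfl, by simp at hv; omega, rfl, h⟩

theorem nil_iff {z : List α} : GapEmb b t [] z ↔ z.length = t * b := by
  refine ⟨fun h => by simpa using h.length_eq, fun h => ?_⟩
  induction t generalizing z with
  | zero =>
    obtain rfl : z = [] := by simpa using h
    exact .nil
  | succ t ih =>
    rw [add_mul, one_mul] at h
    rw [← List.take_append_drop b z]
    exact .gap _ (by rw [List.length_take]; omega) (ih (by rw [List.length_drop]; omega))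

theorem replicate_append (a : α) (u : List α) :
    GapEmb b t (a :: u) (List.replicate (t * b) a ++ a :: u) := by
  induction t with
  | zero => simpa using refl (a :: u)
  | succ t ih =>
    rw [add_mul, one_mul, add_comm (t * b), List.replicate_add, List.append_assoc]
    exact .gap _ (by simp) ih

theorem not_replicate_append (hb : 1 ≤ b) {a c : α} (hac : a ≠ c) (u w : List α) :
    ¬ GapEmb b t (c :: w) (List.replicate (t * b) a ++ a :: u) := by
  induction t with
  | zero =>
    intro h
    have := h.eq_of_zero
    simp [hac] at this
  | succ t ih =>
    intro h
    obtain ⟨d, rfl⟩ : ∃ d, b = d + 1 := ⟨b - 1, by omega⟩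
    have e : (t + 1) * (d + 1) = 1 + (d + t * (d + 1)) := by ring
    rw [e, List.replicate_add, List.replicate_one, List.append_assoc, List.singleton_append] at h
    obtain ⟨s, v, z, hs, hv, hz, h⟩ := h.exists_of_ne hb hac
    obtain rfl : t = s := by omega
    rw [List.replicate_add, List.append_assoc] at hz
    obtain ⟨-, rfl⟩ := List.append_inj hz (by simp [hv])
    exact ih h

theorem exists_separating (hb : 1 ≤ b) (t : ℕ) {y y' : List α} (hlen : y.length = y'.length)
    (hne : y ≠ y') : ∃ z, GapEmb b t y z ∧ ¬ GapEmb b t y' z := by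
  induction y generalizing y' with
  | nil => exact absurd (List.length_eq_zero_iff.1 hlen.symm).symm hne
  | cons a u ih =>
    cases y' with
    | nil => simp at hlen
    | cons c w =>
      by_cases hac : a = c
      · subst hac
        obtain ⟨z, h, h'⟩ := ih (by simpa using hlen) (by simpa using hne)
        exact ⟨a :: z, .cons a h, fun h'' => h' ((cons_self_iff hb).1 h'')⟩
      · exact ⟨_, replicate_append a u, not_replicate_append hb hac u w⟩

end GapEmb

theorem relIter_snoc {α : Type*} {R : α → α → Prop} {t : ℕ} {x y z : α}
    (h : relIter R t x y) (hR : R y z) : relIter R (t + 1) x z := by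
  induction t generalizing x with
  | zero => cases h; exact ⟨z, hR, rfl⟩
  | succ t ih => obtain ⟨w, hw, h⟩ := h; exact ⟨w, hw, ih h⟩

section

variable {q b t : ℕ}

theorem BurstIns.cons (a : Fin q) {y z : List (Fin q)} (h : BurstIns b y z) :
    BurstIns b (a :: y) (a :: z) := by
  obtain ⟨i, v, hi, hv, rfl⟩ := h
  exact ⟨i + 1, v, by simpa using hi, hv, by simp⟩

theorem relIter_burstIns_cons (a : Fin q) {y z : List (Fin q)}
    (h : relIter (BurstIns b) t y z) : relIter (BurstIns b) t (a :: y) (a :: z) := by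
  induction t generalizing y with
  | zero => cases h; rfl
  | succ t ih => obtain ⟨w, hw, h⟩ := h; exact ⟨a :: w, hw.cons a, ih h⟩

theorem GapEmb.of_relIter {s : ℕ} {y z w : List (Fin q)} (h : GapEmb b s y z)
    (hr : relIter (BurstIns b) t z w) : GapEmb b (s + t) y w := by
  induction t generalizing s z with
  | zero => cases hr; exact h
  | succ t ih =>
    obtain ⟨z', ⟨i, v, -, hv, rfl⟩, hr⟩ := hr
    have := ih (h.insert hv i) hr
    rwa [add_assoc, add_comm 1] at this

theorem mem_insBall_iff {y z : List (Fin q)} : z ∈ insBall q b t y ↔ GapEmb b t y z := by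
  constructor
  · intro h
    simpa using (GapEmb.refl y).of_relIter h
  · intro h
    induction h with
    | nil => rfl
    | cons a _ ih => exact relIter_burstIns_cons a ih
    | gap v hv _ ih => exact relIter_snoc ih ⟨0, v, by simp, hv, by simp⟩

theorem finite_setOf_length (q n : ℕ) : {l : List (Fin q) | l.length = n}.Finite :=
  List.finite_length_eq (Fin q) n

theorem ncard_setOf_length (q n : ℕ) : {l : List (Fin q) | l.length = n}.ncard = q ^ n := by
  have := card_vector (α := Fin q) n
  rw [Fintype.card_fin, ← Nat.card_eq_fintype_card] at this
  exact this

theorem setOf_gapEmb_finite (y : List (Fin q)) : {z | GapEmb b t y z}.Finite :=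
  (finite_setOf_length q _).subset fun _ h => GapEmb.length_eq h

theorem setOf_gapEmb_cons (hb : 1 ≤ b) (a : Fin q) (y : List (Fin q)) :
    {z | GapEmb b (t + 1) (a :: y) z} =
      (a :: ·) '' {z | GapEmb b (t + 1) y z} ∪
        (fun p : Fin q × List (Fin q) × List (Fin q) => p.1 :: (p.2.1 ++ p.2.2)) ''
          ({a}ᶜ ×ˢ {v | v.length = b - 1} ×ˢ {w | GapEmb b t (a :: y) w}) := by
  ext z
  constructor
  · intro h
    cases z with
    | nil => have := GapEmb.length_eq h; simp at this; omega
    | cons c z =>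
      by_cases hc : c = a
      · subst hc
        exact .inl ⟨z, (GapEmb.cons_self_iff hb).1 h, rfl⟩
      · obtain ⟨s, v, w, hs, hv, rfl, h⟩ := GapEmb.exists_of_ne hb hc h
        obtain rfl : t = s := by omega
        exact .inr ⟨(c, v, w), ⟨hc, hv, h⟩, rfl⟩
  · rintro (⟨z, h, rfl⟩ | ⟨⟨c, v, w⟩, ⟨-, hv, h⟩, rfl⟩)
    · exact GapEmb.cons a h
    · change v.length = b - 1 at hv
      exact GapEmb.gap (c :: v) (by simp only [List.length_cons]; omega) h

theorem ncard_gapEmb_cons (hb : 1 ≤ b) (a : Fin q) (y : List (Fin q)) :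
    {z | GapEmb b (t + 1) (a :: y) z}.ncard =
      {z | GapEmb b (t + 1) y z}.ncard +
        (q - 1) * (q ^ (b - 1) * {z | GapEmb b t (a :: y) z}.ncard) := by
  have hinj : Set.InjOn
      (fun p : Fin q × List (Fin q) × List (Fin q) => p.1 :: (p.2.1 ++ p.2.2))
      ({a}ᶜ ×ˢ {v | v.length = b - 1} ×ˢ {w | GapEmb b t (a :: y) w}) := by
    rintro ⟨c, v, w⟩ ⟨-, hv, -⟩ ⟨c', v', w'⟩ ⟨-, hv', -⟩ h
    change v.length = b - 1 at hv
    change v'.length = b - 1 at hv'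
    obtain ⟨rfl, h⟩ := List.cons.inj h
    obtain ⟨rfl, rfl⟩ := List.append_inj h (hv.trans hv'.symm)
    rfl
  have hcompl : ({a}ᶜ : Set (Fin q)).ncard = q - 1 := by
    rw [Set.ncard_compl, Set.ncard_singleton, Nat.card_fin]
  rw [setOf_gapEmb_cons hb, Set.ncard_union_eq _ ((setOf_gapEmb_finite y).image _)
    (((Set.toFinite _).prod ((finite_setOf_length q _).prod
      (setOf_gapEmb_finite _))).image _),
    Set.ncard_image_of_injective _ (List.cons_injective), hinj.ncard_image,
    Set.ncard_prod, Set.ncard_prod, ncard_setOf_length, hcompl]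
  rw [Set.disjoint_left]
  rintro _ ⟨z, -, rfl⟩ ⟨⟨c, v, w⟩, ⟨hc, -⟩, h⟩
  exact hc (List.cons.inj h).1

theorem sum_choose_succ_mul_pow (N t r : ℕ) :
    ∑ i ∈ Finset.range (t + 2), (N + 1).choose i * r ^ i =
      ∑ i ∈ Finset.range (t + 2), N.choose i * r ^ i +
        r * ∑ i ∈ Finset.range (t + 1), N.choose i * r ^ i := by
  rw [Finset.sum_range_succ', Finset.sum_range_succ' (fun i => N.choose i * r ^ i),
    Finset.mul_sum]
  simp only [Nat.choose_succ_succ', add_mul, Finset.sum_add_distrib, Nat.choose_zero_right,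
    pow_succ]
  have : ∑ i ∈ Finset.range (t + 1), N.choose i * (r ^ i * r) =
      ∑ i ∈ Finset.range (t + 1), r * (N.choose i * r ^ i) :=
    Finset.sum_congr rfl fun i _ => by ring
  rw [this]
  ring

theorem ncard_gapEmb (hq : 1 ≤ q) (hb : 1 ≤ b) (t : ℕ) (y : List (Fin q)) :
    {z | GapEmb b t y z}.ncard =
      q ^ (t * (b - 1)) *
        ∑ i ∈ Finset.range (t + 1), (y.length + t).choose i * (q - 1) ^ i := by
  induction y generalizing t with
  | nil =>
    simp only [GapEmb.nil_iff, ncard_setOf_length, List.length_nil, zero_add]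
    have h := add_pow (q - 1) 1 t
    rw [Nat.sub_add_cancel hq] at h
    simp only [one_pow, mul_one, Nat.cast_id] at h
    have h' : ∑ i ∈ Finset.range (t + 1), t.choose i * (q - 1) ^ i = q ^ t := by
      rw [h]
      exact Finset.sum_congr rfl fun i _ => mul_comm _ _
    rw [h', ← pow_add]
    obtain ⟨d, rfl⟩ : ∃ d, b = d + 1 := ⟨b - 1, by omega⟩
    simp only [Nat.add_sub_cancel]
    ring
  | cons a y ih =>
    induction t with
    | zero =>
      have : {z | GapEmb b 0 (a :: y) z} = {a :: y} := by
        ext z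
        exact ⟨GapEmb.eq_of_zero, fun h => by cases h; exact .refl _⟩
      simp [this]
    | succ t iht =>
      rw [ncard_gapEmb_cons hb, ih, iht]
      have e : (a :: y).length + (t + 1) = y.length + (t + 1) + 1 := by
        simp only [List.length_cons]; omega
      have e' : (a :: y).length + t = y.length + (t + 1) := by
        simp only [List.length_cons]; omega
      rw [e, e', sum_choose_succ_mul_pow]
      ring

theorem ncard_insBall (hq : 1 ≤ q) (hb : 1 ≤ b) (t : ℕ) (y : List (Fin q)) :
    (insBall q b t y).ncard =
      q ^ (t * (b - 1)) *
        ∑ i ∈ Finset.range (t + 1), (y.length + t).choose i * (q - 1) ^ i := by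
  rw [← ncard_gapEmb hq hb t y]
  congr 1
  ext z
  exact mem_insBall_iff

theorem length_of_mem_delBall {x y : List (Fin q)} (h : y ∈ delBall q b t x) :
    y.length + t * b = x.length := by
  induction t generalizing x with
  | zero => cases h; simp
  | succ t ih =>
    obtain ⟨_, ⟨i, hi, rfl⟩, h⟩ := h
    have := ih h
    rw [List.length_append, List.length_take, List.length_drop] at this
    rw [add_mul, one_mul]
    omega

theorem drop_mem_delBall {x : List (Fin q)} (h : t * b ≤ x.length) :
    x.drop (t * b) ∈ delBall q b t x := by
  induction t generalizing x with
  | zero => simp [delBall, relIter]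
  | succ t ih =>
    rw [add_mul, one_mul] at h ⊢
    refine ⟨x.drop b, ⟨0, by omega, by simp⟩, ?_⟩
    have := ih (x := x.drop b) (by rw [List.length_drop]; omega)
    rw [List.drop_drop, add_comm b] at this
    exact this

theorem insBall_subset_levBall {x y : List (Fin q)} (h : y ∈ delBall q b t x) :
    insBall q b t y ⊆ levBall q b t x :=
  fun _ hz => ⟨y, h, hz⟩

theorem levBall_finite (x : List (Fin q)) : (levBall q b t x).Finite := by
  refine (finite_setOf_length q x.length).subset ?_
  rintro z ⟨y, hy, hz⟩
  change z.length = x.length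
  rw [(mem_insBall_iff.1 hz).length_eq, length_of_mem_delBall hy]

end

/-- the lower bound on `|L_t^b(x)|` is attained iff `|D_t^b(x)| = 1`. -/
theorem levBall_card_eq_iff (q b t n : ℕ) (hq : 2 ≤ q) (hb : 1 ≤ b) (ht : 1 ≤ t)
    (hn : b * t + 1 ≤ n) (x : List (Fin q)) (hx : x.length = n) :
    (levBall q b t x).ncard =
        q ^ (t * (b - 1)) *
          ∑ i ∈ Finset.range (t + 1), (n - t * (b - 1)).choose i * (q - 1) ^ i ↔
      (delBall q b t x).ncard = 1 := by
  have htb : t * (b - 1) + t = t * b := by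
    rw [← Nat.mul_succ]
    congr 1
    omega
  have hcard : ∀ y ∈ delBall q b t x, (insBall q b t y).ncard =
      q ^ (t * (b - 1)) *
        ∑ i ∈ Finset.range (t + 1), (n - t * (b - 1)).choose i * (q - 1) ^ i := by
    intro y hy
    have hlen := length_of_mem_delBall hy
    rw [ncard_insBall (by omega) hb]
    have e : y.length + t = n - t * (b - 1) := by omega
    rw [e]
  have hmem : x.drop (t * b) ∈ delBall q b t x :=
    drop_mem_delBall (by rw [mul_comm]; omega)
  rw [Set.ncard_eq_one]
  constructor
  · intro h
    refine ⟨x.drop (t * b), Set.eq_singleton_iff_unique_mem.2 ⟨hmem, ?_⟩⟩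
    have heq : ∀ y ∈ delBall q b t x, insBall q b t y = levBall q b t x := fun y hy =>
      Set.eq_of_subset_of_ncard_le (insBall_subset_levBall hy) (by rw [h, hcard y hy])
        (levBall_finite x)
    intro y hy
    by_contra hne
    have hlen : y.length = (x.drop (t * b)).length := by
      have h₁ := length_of_mem_delBall hy
      have h₂ := length_of_mem_delBall hmem
      omega
    obtain ⟨z, hz, hz'⟩ := GapEmb.exists_separating hb t hlen hne
    rw [← mem_insBall_iff, heq y hy] at hz
    rw [← mem_insBall_iff, heq _ hmem] at hz'
    exact hz' hz
  · rintro ⟨y, hy⟩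
    have hlev : levBall q b t x = insBall q b t y := by
      ext z
      simp [levBall, hy]
    rw [hlev, hcard y (by simp [hy])]
end

section
/- Let q ≥ 2, b ≥ 1 and n ≥ 2b+1. For every x ∈ Σ_q^n, the fixed-length b-burst Levenshtein ball of radius one satisfies |L_1^b(x)| = q^{b−1}((n−b+1)(q−1)−1) · r_b(x) + 2q^{b−1} − Σ_{j=1}^{b−1} q^{b−j−1} f_{b,j}(x) − Σ_{i=1}^{n−2b} g_{b,i}(x). -/
section Box

variable {q : ℕ}

/-- The sequences of length `n` whose `t`-th entry lies in `S t`. -/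
def box (n : ℕ) (S : ℕ → Finset (Fin q)) : Finset (Fin n → Fin q) :=
  Fintype.piFinset fun t => S t

theorem card_box (n : ℕ) (S : ℕ → Finset (Fin q)) :
    (box n S).card = ∏ t ∈ Finset.range n, (S t).card := by
  rw [box, Fintype.card_piFinset, Fin.prod_univ_eq_prod_range (fun t => (S t).card)]

theorem prod_range_eq_pow_mul {c : ℕ → ℕ} {n u v w a r : ℕ} (hv : v ≤ n) (hw : w < n)
    (h : ∀ t < n, c t = (if u ≤ t ∧ t < v then a else 1) * (if t = w then r else 1)) :
    ∏ t ∈ Finset.range n, c t = a ^ (v - u) * r := by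
  rw [Finset.prod_congr rfl fun t ht => h t (Finset.mem_range.1 ht), Finset.prod_mul_distrib,
    Finset.prod_ite_eq' (Finset.range n) w, if_pos (Finset.mem_range.2 hw)]
  congr 1
  rw [← Finset.prod_filter, Finset.prod_const]
  congr 1
  rw [← Nat.card_Ico]
  congr 1
  ext t
  simp only [Finset.mem_filter, Finset.mem_range, Finset.mem_Ico]
  omega

variable (m b : ℕ) (X : ℕ → Fin q)

/-- Sequences agreeing with `X` in the first `m + 1` positions. -/
def tailSet : Finset (Fin (m + b) → Fin q) :=
  box (m + b) fun t => if t ≤ m then {X t} else Finset.univ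

/-- Sequences whose first difference with `X` is at `w`, all differences lying in a window of
length `b`. -/
def windowSet (w : ℕ) : Finset (Fin (m + b) → Fin q) :=
  box (m + b) fun t =>
    if t < w then {X t} else if t = w then {X t}ᶜ else if t < w + b then Finset.univ else {X t}

/-- Sequences with first difference `p` and last difference `s + b` that arise by deleting on the
left and inserting on the right. -/
def leftSet (p s : ℕ) : Finset (Fin (m + b) → Fin q) :=
  if X p ≠ X (p + b) then
    box (m + b) fun t =>
      if t < p then {X t} else if t ≤ s then {X (t + b)} else if t < s + b then Finset.univ
      else if t = s + b then {X t}ᶜ else {X t}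
  else ∅

/-- Sequences with first difference `p` and last difference `s + b` that arise by deleting on the
right and inserting on the left. -/
def rightSet (p s : ℕ) : Finset (Fin (m + b) → Fin q) :=
  if X s ≠ X (s + b) then
    box (m + b) fun t =>
      if t < p then {X t} else if t = p then {X t}ᶜ else if t < p + b then Finset.univ
      else if t ≤ s + b then {X (t - b)} else {X t}
  else ∅

theorem card_tailSet (hb : 1 ≤ b) : (tailSet m b X).card = q ^ (b - 1) := by
  rw [tailSet, card_box, prod_range_eq_pow_mul (u := m + 1) (v := m + b) (w := 0) (a := q)
    (r := 1) le_rfl (by omega), mul_one]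
  · congr 1; omega
  · intro t ht
    split_ifs <;> first | omega | simp

theorem card_windowSet (hb : 1 ≤ b) {w : ℕ} (hw : w ≤ m) :
    (windowSet m b X w).card = q ^ (b - 1) * (q - 1) := by
  rw [windowSet, card_box, prod_range_eq_pow_mul (u := w + 1) (v := w + b) (w := w) (a := q)
    (r := q - 1) (by omega) (by omega)]
  · congr 2; omega
  · intro t ht
    split_ifs <;> first | omega | simp [Finset.card_compl]

theorem card_leftSet (hb : 1 ≤ b) {p s : ℕ} (hps : p ≤ s) (hs : s < m) :
    (leftSet m b X p s).card = if X p ≠ X (p + b) then q ^ (b - 1) * (q - 1) else 0 := by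
  unfold leftSet
  split_ifs
  · rw [card_box, prod_range_eq_pow_mul (u := s + 1) (v := s + b) (w := s + b) (a := q)
      (r := q - 1) (by omega) (by omega)]
    · congr 2; omega
    · intro t ht
      split_ifs <;> first | omega | simp [Finset.card_compl]
  · rfl

theorem card_rightSet (hb : 1 ≤ b) {p s : ℕ} (hps : p ≤ s) (hs : s < m) :
    (rightSet m b X p s).card = if X s ≠ X (s + b) then q ^ (b - 1) * (q - 1) else 0 := by
  unfold rightSet
  split_ifs
  · rw [card_box, prod_range_eq_pow_mul (u := p + 1) (v := p + b) (w := p) (a := q)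
      (r := q - 1) (by omega) (by omega)]
    · congr 2; omega
    · intro t ht
      split_ifs <;> first | omega | simp [Finset.card_compl]
  · rfl

variable [NeZero q]

/-- The sequence `z` of length `n`, extended by zero to a function on `ℕ`. -/
def extendZero {n : ℕ} (z : Fin n → Fin q) (t : ℕ) : Fin q :=
  if h : t < n then z ⟨t, h⟩ else 0

theorem mem_box {n : ℕ} {S : ℕ → Finset (Fin q)} {z : Fin n → Fin q} :
    z ∈ box n S ↔ ∀ t < n, extendZero z t ∈ S t := by
  simp only [box, Fintype.mem_piFinset, extendZero]
  constructor
  · intro h t ht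
    simpa [ht] using h ⟨t, ht⟩
  · intro h t
    simpa using h t t.2

theorem mem_tailSet {z : Fin (m + b) → Fin q} : z ∈ tailSet m b X ↔
    ∀ t < m + b, t ≤ m → extendZero z t = X t := by
  simp only [tailSet, mem_box]
  refine forall₂_congr fun t _ => ?_
  split_ifs <;> simp_all

theorem mem_windowSet (hb : 1 ≤ b) {w : ℕ} (hw : w ≤ m) {z : Fin (m + b) → Fin q} :
    z ∈ windowSet m b X w ↔ extendZero z w ≠ X w ∧
      ∀ t < m + b, t < w ∨ w + b ≤ t → extendZero z t = X t := by
  simp only [windowSet, mem_box]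
  constructor
  · intro h
    refine ⟨by simpa using h w (by omega), fun t ht h' => ?_⟩
    have := h t ht
    split_ifs at this <;> first | omega | simpa using this
  · rintro ⟨h0, h⟩ t ht
    split_ifs
    · simpa using h t ht (by omega)
    · subst t; simpa using h0
    · simp
    · simpa using h t ht (by omega)

theorem mem_leftSet (hb : 1 ≤ b) {p s : ℕ} (hps : p ≤ s) (hs : s < m)
    {z : Fin (m + b) → Fin q} :
    z ∈ leftSet m b X p s ↔ extendZero z p ≠ X p ∧ extendZero z (s + b) ≠ X (s + b) ∧
      (∀ t < m + b, t < p ∨ s + b < t → extendZero z t = X t) ∧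
      ∀ t, p ≤ t → t ≤ s → extendZero z t = X (t + b) := by
  unfold leftSet
  split_ifs with hd
  · rw [mem_box]
    constructor
    · intro h
      have h4 : ∀ t, p ≤ t → t ≤ s → extendZero z t = X (t + b) := fun t h1 h2 => by
        have := h t (by omega)
        split_ifs at this <;> first | omega | simpa using this
      refine ⟨?_, ?_, fun t ht h' => ?_, h4⟩
      · rw [h4 p le_rfl hps]; exact hd.symm
      · have := h (s + b) (by omega)
        split_ifs at this <;> first | omega | simpa using this
      · have := h t ht
        split_ifs at this <;> first | omega | simpa using this
    · rintro ⟨h1, h2, h3, h4⟩ t ht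
      split_ifs
      · simpa using h3 t ht (by omega)
      · simpa using h4 t (by omega) (by omega)
      · simp
      · subst t; simpa using h2
      · simpa using h3 t ht (by omega)
  · simp only [Finset.notMem_empty, false_iff]
    rintro ⟨h1, -, -, h4⟩
    exact hd fun h => h1 ((h4 p le_rfl hps).trans h.symm)

theorem mem_rightSet (hb : 1 ≤ b) {p s : ℕ} (hps : p ≤ s) (hs : s < m)
    {z : Fin (m + b) → Fin q} :
    z ∈ rightSet m b X p s ↔ extendZero z p ≠ X p ∧ extendZero z (s + b) ≠ X (s + b) ∧
      (∀ t < m + b, t < p ∨ s + b < t → extendZero z t = X t) ∧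
      ∀ t, p ≤ t → t ≤ s → extendZero z (t + b) = X t := by
  unfold rightSet
  split_ifs with hd
  · rw [mem_box]
    constructor
    · intro h
      have h4 : ∀ t, p ≤ t → t ≤ s → extendZero z (t + b) = X t := fun t h1 h2 => by
        have := h (t + b) (by omega)
        split_ifs at this <;> first | omega | simpa using this
      refine ⟨?_, ?_, fun t ht h' => ?_, h4⟩
      · have := h p (by omega)
        split_ifs at this <;> first | omega | simpa using this
      · rw [h4 s hps le_rfl]; exact hd
      · have := h t ht
        split_ifs at this <;> first | omega | simpa using this
    · rintro ⟨h1, h2, h3, h4⟩ t ht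
      split_ifs
      · simpa using h3 t ht (by omega)
      · subst t; simpa using h1
      · simp
      · have := h4 (t - b) (by omega) (by omega)
        rw [Nat.sub_add_cancel (by omega)] at this
        simpa using this
      · simpa using h3 t ht (by omega)
  · simp only [Finset.notMem_empty, false_iff]
    rintro ⟨-, h2, -, h4⟩
    exact hd fun h => h2 ((h4 s hps le_rfl).trans h)

theorem card_leftSet_inter_rightSet (hb : 1 ≤ b) {p s : ℕ} (hps : p ≤ s) (hs : s < m) :
    (leftSet m b X p s ∩ rightSet m b X p s).card =
      if X p ≠ X (p + b) ∧ X s ≠ X (s + b) then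
        if s < p + b then q ^ (b - 1 - (s - p))
        else if ∀ t ∈ Finset.Icc p (s - b), X t = X (t + 2 * b) then 1 else 0
      else 0 := by
  by_cases hd : X p ≠ X (p + b) ∧ X s ≠ X (s + b)
  swap
  · rw [if_neg hd, leftSet, rightSet]
    split_ifs <;> simp_all
  have hbox : leftSet m b X p s ∩ rightSet m b X p s = box (m + b) fun t =>
      if t < p then {X t} else if t ≤ s then
        if p + b ≤ t then {X (t + b)} ∩ {X (t - b)} else {X (t + b)}
      else if t < p + b then Finset.univ else if t ≤ s + b then {X (t - b)} else {X t} := by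
    ext z
    rw [Finset.mem_inter, mem_leftSet m b X hb hps hs, mem_rightSet m b X hb hps hs, mem_box]
    constructor
    · rintro ⟨⟨-, -, h1, h2⟩, -, -, -, h3⟩ t ht
      have h3' : p + b ≤ t → t ≤ s + b → extendZero z t = X (t - b) := fun h4 h5 => by
        have := h3 (t - b) (by omega) (by omega)
        rwa [Nat.sub_add_cancel (by omega)] at this
      split_ifs
      · simpa using h1 t ht (by omega)
      · rw [Finset.mem_inter, Finset.mem_singleton, Finset.mem_singleton]
        exact ⟨h2 t (by omega) (by omega), h3' (by omega) (by omega)⟩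
      · simpa using h2 t (by omega) (by omega)
      · simp
      · simpa using h3' (by omega) (by omega)
      · simpa using h1 t ht (by omega)
    · intro h
      have hA : ∀ t, p ≤ t → t ≤ s → extendZero z t = X (t + b) := fun t h1 h2 => by
        have := h t (by omega)
        split_ifs at this <;> first
          | omega | exact Finset.mem_singleton.1 (Finset.mem_inter.1 this).1 | simpa using this
      have hB : ∀ t, p ≤ t → t ≤ s → extendZero z (t + b) = X t := fun t h1 h2 => by
        have := h (t + b) (by omega)
        rw [Nat.add_sub_cancel] at this
        split_ifs at this <;> first
          | omega | exact Finset.mem_singleton.1 (Finset.mem_inter.1 this).2 | simpa using this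
      have hC : ∀ t < m + b, t < p ∨ s + b < t → extendZero z t = X t := fun t ht h' => by
        have := h t ht
        split_ifs at this <;> first | omega | simpa using this
      have hp : extendZero z p ≠ X p := by rw [hA p le_rfl hps]; exact hd.1.symm
      have hq : extendZero z (s + b) ≠ X (s + b) := by rw [hB s hps le_rfl]; exact hd.2
      exact ⟨⟨hp, hq, hC, hA⟩, hp, hq, hC, hB⟩
  rw [hbox, card_box, if_pos hd]
  split_ifs with h1 h2
  · rw [prod_range_eq_pow_mul (u := s + 1) (v := p + b) (w := 0) (a := q)
      (r := 1) (by omega) (by omega), mul_one]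
    · congr 1; omega
    · intro t ht
      split_ifs <;> first | omega | simp
  · refine Finset.prod_eq_one fun t ht => ?_
    split_ifs <;> first | omega | exact Finset.card_singleton _ | skip
    have := h2 (t - b) (Finset.mem_Icc.2 ⟨by omega, by omega⟩)
    rw [this, show t - b + 2 * b = t + b by omega, Finset.inter_self, Finset.card_singleton]
  · push Not at h2
    obtain ⟨t, ht, hne⟩ := h2
    rw [Finset.mem_Icc] at ht
    refine Finset.prod_eq_zero (i := t + b) (Finset.mem_range.2 (by omega)) ?_
    rw [if_neg (by omega), if_pos (by omega), if_pos (by omega), Nat.add_sub_cancel,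
      show t + b + b = t + 2 * b by omega]
    simp [hne.symm]

end Box

/-- Deleting `b` entries of `X` at some position and `b` entries of `Z` at some position can give
the same sequence of length `m`. -/
def ShareBurstDel {α : Type*} (m b : ℕ) (X Z : ℕ → α) : Prop :=
  ∃ i ≤ m, ∃ j ≤ m, ∀ t < m,
    (if t < i then X t else X (t + b)) = if t < j then Z t else Z (t + b)

theorem exists_first_last_ne {α : Type*} {N : ℕ} {X Z : ℕ → α} (h : ∃ t < N, Z t ≠ X t) :
    ∃ p s, p ≤ s ∧ s < N ∧ Z p ≠ X p ∧ Z s ≠ X s ∧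
      ∀ t < N, t < p ∨ s < t → Z t = X t := by
  classical
  obtain ⟨t, ht, hne⟩ := h
  let D := (Finset.range N).filter fun t => Z t ≠ X t
  have hmem : ∀ t, t ∈ D ↔ t < N ∧ Z t ≠ X t := by simp [D]
  have hD : D.Nonempty := ⟨t, (hmem t).2 ⟨ht, hne⟩⟩
  have hmin := (hmem _).1 (D.min'_mem hD)
  have hmax := (hmem _).1 (D.max'_mem hD)
  refine ⟨D.min' hD, D.max' hD, D.min'_le_max' hD, hmax.1, hmin.2, hmax.2, fun t ht h' => ?_⟩
  by_contra hc
  have h1 := D.min'_le t ((hmem t).2 ⟨ht, hc⟩)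
  have h2 := D.le_max' t ((hmem t).2 ⟨ht, hc⟩)
  omega

theorem shareBurstDel_iff {α : Type*} {m b : ℕ} (hb : 1 ≤ b) (X Z : ℕ → α) :
    ShareBurstDel m b X Z ↔
      (∀ t < m + b, t ≤ m → Z t = X t) ∨
      (∃ w ≤ m, Z w ≠ X w ∧ ∀ t < m + b, t < w ∨ w + b ≤ t → Z t = X t) ∨
      ∃ p s, p ≤ s ∧ s < m ∧ Z p ≠ X p ∧ Z (s + b) ≠ X (s + b) ∧
        (∀ t < m + b, t < p ∨ s + b < t → Z t = X t) ∧
        ((∀ t, p ≤ t → t ≤ s → Z t = X (t + b)) ∨ ∀ t, p ≤ t → t ≤ s → Z (t + b) = X t) := by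
  constructor
  · rintro ⟨i, hi, j, hj, h⟩
    by_cases hne : ∃ t < m + b, Z t ≠ X t
    swap
    · left
      push Not at hne
      exact fun t ht _ => hne t ht
    obtain ⟨p, s, hps, hs, hp, hs', hout⟩ := exists_first_last_ne hne
    by_cases hsp : s < p + b
    · by_cases hpm : p ≤ m
      · exact Or.inr (Or.inl ⟨p, hpm, hp, fun t ht h' => hout t ht (by omega)⟩)
      · exact Or.inl fun t ht h' => hout t ht (by omega)
    obtain ⟨s, rfl⟩ : ∃ s', s = s' + b := ⟨s - b, by omega⟩
    refine Or.inr (Or.inr ⟨p, s, by omega, by omega, hp, hs', hout, ?_⟩)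
    have h_p : ¬ (p < i ∧ p < j) := fun h' => hp (by
      have := h p (by omega)
      rw [if_pos h'.1, if_pos h'.2] at this
      exact this.symm)
    have h_s : ¬ (i ≤ s ∧ j ≤ s) := fun h' => hs' (by
      have := h s (by omega)
      rw [if_neg (by omega), if_neg (by omega)] at this
      exact this.symm)
    rcases le_or_gt i j with hij | hij
    · left
      intro t h1 h2
      have := h t (by omega)
      rw [if_neg (by omega), if_pos (by omega)] at this
      exact this.symm
    · right
      intro t h1 h2
      have := h t (by omega)
      rw [if_pos (by omega), if_neg (by omega)] at this
      exact this.symm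
  · rintro (h | ⟨w, hw, -, h⟩ | ⟨p, s, hps, hs, -, -, hout, h | h⟩)
    · refine ⟨m, le_rfl, m, le_rfl, fun t ht => ?_⟩
      rw [if_pos ht, if_pos ht, h t (by omega) ht.le]
    · refine ⟨w, hw, w, hw, fun t ht => ?_⟩
      split_ifs
      · exact (h t (by omega) (by omega)).symm
      · exact (h (t + b) (by omega) (by omega)).symm
    · refine ⟨p, by omega, s + 1, by omega, fun t ht => ?_⟩
      split_ifs
      · exact (hout t (by omega) (by omega)).symm
      · omega
      · exact (h t (by omega) (by omega)).symm
      · exact (hout (t + b) (by omega) (by omega)).symm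
    · refine ⟨s + 1, by omega, p, by omega, fun t ht => ?_⟩
      split_ifs
      · exact (hout t (by omega) (by omega)).symm
      · exact (h t (by omega) (by omega)).symm
      · omega
      · exact (hout (t + b) (by omega) (by omega)).symm

section Count

variable {q : ℕ} [NeZero q] (m b : ℕ) (X : ℕ → Fin q)

open Classical in
theorem filter_shareBurstDel_eq (hb : 1 ≤ b) :
    (Finset.univ.filter fun z : Fin (m + b) → Fin q => ShareBurstDel m b X (extendZero z)) =
      (tailSet m b X ∪ (Finset.range (m + 1)).biUnion (windowSet m b X)) ∪
        ((Finset.range m).sigma fun p => Finset.Ico p m).biUnion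
          fun a => leftSet m b X a.1 a.2 ∪ rightSet m b X a.1 a.2 := by
  ext z
  simp only [Finset.mem_filter, Finset.mem_univ, true_and, shareBurstDel_iff hb,
    Finset.mem_union, Finset.mem_biUnion, Finset.mem_sigma, Finset.mem_range, Finset.mem_Ico,
    mem_tailSet, or_assoc]
  refine or_congr Iff.rfl (or_congr (exists_congr fun w => ?_) ⟨?_, ?_⟩)
  · rw [Nat.lt_succ_iff]
    exact and_congr_right fun hw => (mem_windowSet m b X hb hw).symm
  · rintro ⟨p, s, hps, hs, h1, h2, h3, h4⟩
    refine ⟨⟨p, s⟩, ⟨hps.trans_lt hs, hps, hs⟩, ?_⟩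
    rw [mem_leftSet m b X hb hps hs, mem_rightSet m b X hb hps hs]
    exact h4.imp (fun h => ⟨h1, h2, h3, h⟩) fun h => ⟨h1, h2, h3, h⟩
  · rintro ⟨⟨p, s⟩, ⟨-, hps, hs⟩, h⟩
    rw [mem_leftSet m b X hb hps hs, mem_rightSet m b X hb hps hs] at h
    rcases h with ⟨h1, h2, h3, h4⟩ | ⟨h1, h2, h3, h4⟩
    · exact ⟨p, s, hps, hs, h1, h2, h3, Or.inl h4⟩
    · exact ⟨p, s, hps, hs, h1, h2, h3, Or.inr h4⟩

theorem mem_leftSet_union_rightSet (hb : 1 ≤ b) {p s : ℕ} (hps : p ≤ s) (hs : s < m)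
    {z : Fin (m + b) → Fin q} (hz : z ∈ leftSet m b X p s ∪ rightSet m b X p s) :
    extendZero z p ≠ X p ∧ extendZero z (s + b) ≠ X (s + b) ∧
      ∀ t < m + b, t < p ∨ s + b < t → extendZero z t = X t := by
  rw [Finset.mem_union, mem_leftSet m b X hb hps hs, mem_rightSet m b X hb hps hs] at hz
  tauto

open Classical in
theorem card_filter_shareBurstDel (hb : 1 ≤ b) :
    (Finset.univ.filter fun z : Fin (m + b) → Fin q =>
      ShareBurstDel m b X (extendZero z)).card =
      q ^ (b - 1) + (m + 1) * (q ^ (b - 1) * (q - 1)) +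
        ∑ p ∈ Finset.range m, ∑ s ∈ Finset.Ico p m,
          (leftSet m b X p s ∪ rightSet m b X p s).card := by
  rw [filter_shareBurstDel_eq m b X hb, Finset.card_union_of_disjoint,
    Finset.card_union_of_disjoint, card_tailSet m b X hb, Finset.card_biUnion,
    Finset.card_biUnion, Finset.sum_sigma]
  · congr 2
    rw [Finset.sum_congr rfl fun w hw =>
      card_windowSet m b X hb (Nat.lt_succ_iff.1 (Finset.mem_range.1 hw))]
    simp
  · rintro ⟨p, s⟩ ha ⟨p', s'⟩ ha' hne
    rw [Finset.mem_coe, Finset.mem_sigma, Finset.mem_range, Finset.mem_Ico] at ha ha'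
    dsimp only at ha ha'
    refine Finset.disjoint_left.2 fun z hz hz' => hne ?_
    obtain ⟨h1, h2, h3⟩ := mem_leftSet_union_rightSet m b X hb ha.2.1 ha.2.2 hz
    obtain ⟨h1', h2', h3'⟩ := mem_leftSet_union_rightSet m b X hb ha'.2.1 ha'.2.2 hz'
    have e1 : ¬ p < p' := fun h => h1 (h3' p (by omega) (by omega))
    have e2 : ¬ p' < p := fun h => h1' (h3 p' (by omega) (by omega))
    have e3 : ¬ s < s' := fun h => h2' (h3 (s' + b) (by omega) (by omega))
    have e4 : ¬ s' < s := fun h => h2 (h3' (s + b) (by omega) (by omega))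
    obtain rfl : p = p' := by omega
    obtain rfl : s = s' := by omega
    rfl
  · intro w hw w' hw' hne
    rw [Finset.mem_coe, Finset.mem_range] at hw hw'
    refine Finset.disjoint_left.2 fun z hz hz' => hne ?_
    rw [mem_windowSet m b X hb (by omega)] at hz hz'
    have e1 : ¬ w < w' := fun h => hz.1 (hz'.2 w (by omega) (by omega))
    have e2 : ¬ w' < w := fun h => hz'.1 (hz.2 w' (by omega) (by omega))
    omega
  · refine Finset.disjoint_left.2 fun z hz hz' => ?_
    simp only [Finset.mem_biUnion, Finset.mem_range] at hz'
    obtain ⟨w, hw, hz'⟩ := hz'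
    rw [mem_windowSet m b X hb (by omega)] at hz'
    exact hz'.1 ((mem_tailSet m b X).1 hz w (by omega) (by omega))
  · refine Finset.disjoint_left.2 fun z hz hz' => ?_
    simp only [Finset.mem_biUnion, Finset.mem_sigma, Finset.mem_range, Finset.mem_Ico] at hz'
    obtain ⟨⟨p, s⟩, ⟨-, hps, hs⟩, hz'⟩ := hz'
    obtain ⟨h1, h2, h3⟩ := mem_leftSet_union_rightSet m b X hb hps hs hz'
    dsimp only at hps hs h1 h2 h3
    rcases Finset.mem_union.1 hz with hz | hz
    · exact h1 ((mem_tailSet m b X).1 hz p (by omega) (by omega))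
    · simp only [Finset.mem_biUnion, Finset.mem_range] at hz
      obtain ⟨w, hw, hz⟩ := hz
      rw [mem_windowSet m b X hb (by omega)] at hz
      by_cases hpw : p < w
      · exact h1 (hz.2 p (by omega) (by omega))
      · by_cases hws : w + b ≤ s + b
        · exact h2 (hz.2 (s + b) (by omega) (by omega))
        · omega

end Count

section Sums

theorem sum_range_sum_Ico_add (m : ℕ) (δ : ℕ → ℤ) :
    ∑ p ∈ Finset.range m, ∑ s ∈ Finset.Ico p m, (δ p + δ s) =
      (m + 1) * ∑ p ∈ Finset.range m, δ p := by
  induction m with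
  | zero => simp
  | succ m ih =>
    have h : ∀ p ∈ Finset.range (m + 1), ∑ s ∈ Finset.Ico p (m + 1), (δ p + δ s) =
        ∑ s ∈ Finset.Ico p m, (δ p + δ s) + (δ p + δ m) := fun p hp =>
      Finset.sum_Ico_succ_top (Nat.lt_succ_iff.1 (Finset.mem_range.1 hp)) _
    rw [Finset.sum_congr rfl h, Finset.sum_add_distrib, Finset.sum_range_succ, ih,
      Finset.sum_add_distrib]
    simp only [Finset.Ico_self, Finset.sum_empty, Finset.sum_const, Finset.card_empty, Finset.card_range,
      nsmul_eq_mul, Finset.sum_range_succ, Finset.sum_add_distrib]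
    push_cast
    ring

theorem sum_range_sum_Ico_split (m b : ℕ) (F G : ℕ → ℕ → ℤ) :
    ∑ p ∈ Finset.range m, ∑ s ∈ Finset.Ico p m, (if s < p + b then F p s else G p s) =
      ∑ j ∈ Finset.range b, ∑ p ∈ Finset.range (m - j), F p (p + j) +
        ∑ p ∈ Finset.range (m - b), ∑ s ∈ Finset.Ico (p + b) m, G p s := by
  have h1 : ∀ p ∈ Finset.range m,
      ∑ s ∈ Finset.Ico p m, (if s < p + b then F p s else G p s) =
        ∑ j ∈ Finset.range b, (if p + j < m then F p (p + j) else 0) +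
          ∑ s ∈ Finset.Ico (p + b) m, G p s := by
    intro p _
    rw [Finset.sum_ite]
    congr 1
    · rw [← Finset.sum_filter]
      refine Finset.sum_bij' (fun s _ => s - p) (fun j _ => p + j) ?_ ?_ ?_ ?_ ?_
      all_goals simp only [Finset.mem_filter, Finset.mem_Ico, Finset.mem_range]
      · intro s hs; omega
      · intro s hs; omega
      · intro s hs; omega
      · intro s hs; omega
      · intro s hs; rw [Nat.add_sub_cancel' (by omega)]
    · refine Finset.sum_congr ?_ fun _ _ => rfl
      ext s
      simp only [Finset.mem_filter, Finset.mem_Ico]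
      omega
  rw [Finset.sum_congr rfl h1, Finset.sum_add_distrib, Finset.sum_comm]
  congr 1
  · refine Finset.sum_congr rfl fun j _ => ?_
    rw [← Finset.sum_filter]
    refine Finset.sum_congr ?_ fun _ _ => rfl
    ext p
    simp only [Finset.mem_filter, Finset.mem_range]
    omega
  · symm
    refine Finset.sum_subset (fun p hp => ?_) fun p _ hp => ?_
    · simp only [Finset.mem_range] at *; omega
    · rw [Finset.Ico_eq_empty, Finset.sum_empty]
      simp only [Finset.mem_range] at *; omega

end Sums

section Lists

variable {q : ℕ}

theorem burstIns_iff_burstDel {b : ℕ} {y z : List (Fin q)} :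
    BurstIns b y z ↔ BurstDel b z y := by
  constructor
  · rintro ⟨i, v, hi, hv, rfl⟩
    refine ⟨i, by simp; omega, ?_⟩
    have h1 : (y.take i).length = i := by simp [hi]
    have h2 : (y.take i ++ v).length = i + b := by simp [hv]; omega
    rw [List.drop_left' h2, List.append_assoc, List.take_left' h1, List.take_append_drop]
  · rintro ⟨i, hi, rfl⟩
    have h1 : (z.take i).length = i := by simp; omega
    refine ⟨i, (z.drop i).take b, by simp; omega, by simp; omega, ?_⟩
    rw [List.take_left' h1, List.drop_left' h1, List.append_assoc, ← List.drop_drop,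
      List.take_append_drop, List.take_append_drop]

theorem mem_levBall_one {b : ℕ} {x z : List (Fin q)} :
    z ∈ levBall q b 1 x ↔ ∃ y, BurstDel b x y ∧ BurstDel b z y := by
  simp [levBall, delBall, insBall, relIter, burstIns_iff_burstDel]

theorem getElem?_take_append_drop (l : List (Fin q)) {i b : ℕ} (hi : i + b ≤ l.length) (t : ℕ) :
    (l.take i ++ l.drop (i + b))[t]? = if t < i then l[t]? else l[t + b]? := by
  rw [List.getElem?_append]
  simp only [List.length_take, List.getElem?_take, List.getElem?_drop]
  rw [min_eq_left (by omega)]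
  split_ifs
  · rfl
  · congr 1; omega

theorem length_of_mem_levBall_one {b : ℕ} {x z : List (Fin q)} (h : z ∈ levBall q b 1 x) :
    z.length = x.length := by
  obtain ⟨y, ⟨i, hi, hy⟩, ⟨j, hj, hy'⟩⟩ := mem_levBall_one.1 h
  have := congrArg List.length (hy.symm.trans hy')
  simp at this
  omega

variable [NeZero q]

theorem mem_levBall_one_ofFn {m b : ℕ} (x z : Fin (m + b) → Fin q) :
    List.ofFn z ∈ levBall q b 1 (List.ofFn x) ↔
      ShareBurstDel m b (extendZero x) (extendZero z) := by
  have hget : ∀ (w : Fin (m + b) → Fin q) (t : ℕ), t < m + b →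
      (List.ofFn w)[t]? = some (extendZero w t) := fun w t ht => by
    simp [extendZero, ht]
  have hdel : ∀ (w : Fin (m + b) → Fin q) (i t : ℕ), i ≤ m → t < m →
      ((List.ofFn w).take i ++ (List.ofFn w).drop (i + b))[t]? =
        some (if t < i then extendZero w t else extendZero w (t + b)) := fun w i t hi ht => by
    rw [getElem?_take_append_drop _ (by simpa using hi), hget w t (by omega),
      hget w (t + b) (by omega), apply_ite some]
  rw [mem_levBall_one]
  constructor
  · rintro ⟨y, ⟨i, hi, hy⟩, ⟨j, hj, hy'⟩⟩
    rw [List.length_ofFn] at hi hj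
    refine ⟨i, by omega, j, by omega, fun t ht => ?_⟩
    rw [← Option.some_inj, ← hdel x i t (by omega) ht, ← hdel z j t (by omega) ht, ← hy, hy']
  · rintro ⟨i, hi, j, hj, h⟩
    refine ⟨_, ⟨i, by simpa using hi, rfl⟩, ⟨j, by simpa using hj, ?_⟩⟩
    refine List.ext_getElem? fun t => ?_
    by_cases ht : t < m
    · rw [hdel x i t hi ht, hdel z j t hj ht, h t ht]
    · rw [List.getElem?_eq_none (by simp; omega), List.getElem?_eq_none (by simp; omega)]

open Classical in
theorem ncard_levBall_one {m b : ℕ} (x : Fin (m + b) → Fin q) :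
    (levBall q b 1 (List.ofFn x)).ncard =
      (Finset.univ.filter fun z : Fin (m + b) → Fin q =>
        ShareBurstDel m b (extendZero x) (extendZero z)).card := by
  rw [← Set.ncard_coe_finset, ← Set.ncard_image_of_injective _ List.ofFn_injective]
  congr 1
  ext l
  simp only [Set.mem_image, Finset.coe_filter, Finset.mem_univ, true_and, Set.mem_ofPred_eq]
  constructor
  · intro h
    have hl : l.length = m + b := by simpa using length_of_mem_levBall_one h
    obtain ⟨z, rfl⟩ : ∃ z : Fin (m + b) → Fin q, List.ofFn z = l := by
      exact ⟨fun t => l[t]'(by omega), List.ext_getElem (by simp [hl]) (by simp)⟩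
    exact ⟨z, (mem_levBall_one_ofFn x z).1 h, rfl⟩
  · rintro ⟨z, hz, rfl⟩
    exact (mem_levBall_one_ofFn x z).2 hz

theorem getElem?_ofFn_ne_iff {n : ℕ} (x : Fin n → Fin q) {s t : ℕ} (hs : s < n) (ht : t < n) :
    (List.ofFn x)[s]? ≠ (List.ofFn x)[t]? ↔ extendZero x s ≠ extendZero x t := by
  simp [extendZero, hs, ht]

end Lists

section Statistics

variable {q : ℕ} [NeZero q]

theorem rB_ofFn {m b : ℕ} (x : Fin (m + b) → Fin q) :
    (rB q b (List.ofFn x) : ℤ) = 1 + ∑ p ∈ Finset.range m,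
      if extendZero x p ≠ extendZero x (p + b) then 1 else 0 := by
  rw [rB, List.length_ofFn, Nat.add_sub_cancel, Finset.card_filter]
  push_cast
  congr 1
  refine Finset.sum_congr rfl fun p hp => if_congr ?_ rfl rfl
  rw [Finset.mem_range] at hp
  exact getElem?_ofFn_ne_iff x (by omega) (by omega)

theorem fB_ofFn {m b : ℕ} (j : ℕ) (x : Fin (m + b) → Fin q) :
    (fB q b j (List.ofFn x) : ℤ) = ∑ p ∈ Finset.range (m - j),
      if extendZero x p ≠ extendZero x (p + b) ∧
        extendZero x (p + j) ≠ extendZero x (p + j + b) then 1 else 0 := by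
  rw [fB, List.length_ofFn, Nat.add_sub_cancel, Finset.card_filter]
  push_cast
  refine Finset.sum_congr rfl fun p hp => if_congr (and_congr ?_ ?_) rfl rfl <;>
    rw [Finset.mem_range] at hp
  · exact getElem?_ofFn_ne_iff x (by omega) (by omega)
  · exact getElem?_ofFn_ne_iff x (by omega) (by omega)

theorem gB_ofFn {m b : ℕ} {i : ℕ} (hi : i < m - b) (x : Fin (m + b) → Fin q) :
    (gB q b i (List.ofFn x) : ℤ) = ∑ s ∈ Finset.Ico (i + b) m,
      if extendZero x i ≠ extendZero x (i + b) ∧ extendZero x s ≠ extendZero x (s + b) then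
        if ∀ t ∈ Finset.Icc i (s - b), extendZero x t = extendZero x (t + 2 * b) then 1 else 0
      else 0 := by
  have hIcc : Finset.Icc (i + b) (m - 1) = Finset.Ico (i + b) m := by
    ext t
    simp only [Finset.mem_Icc, Finset.mem_Ico]
    omega
  rw [gB, List.length_ofFn, Nat.add_sub_cancel, Finset.card_filter, hIcc]
  push_cast
  refine Finset.sum_congr rfl fun s hs => ?_
  rw [Finset.mem_Ico] at hs
  rw [← ite_and]
  refine if_congr
    ((and_congr ?_ (and_congr ?_ (forall₂_congr fun t ht => ?_))).trans and_assoc.symm) rfl rfl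
  · exact getElem?_ofFn_ne_iff x (by omega) (by omega)
  · exact getElem?_ofFn_ne_iff x (by omega) (by omega)
  · rw [Finset.mem_Icc] at ht
    exact not_iff_not.1 (getElem?_ofFn_ne_iff x (by omega) (by omega))

theorem sum_card_leftSet_inter_rightSet {m b : ℕ} (hb : 1 ≤ b) (x : Fin (m + b) → Fin q) :
    (∑ p ∈ Finset.range m, ∑ s ∈ Finset.Ico p m,
      ((leftSet m b (extendZero x) p s ∩ rightSet m b (extendZero x) p s).card : ℤ)) =
      (q : ℤ) ^ (b - 1) * (rB q b (List.ofFn x) - 1)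
        + ∑ j ∈ Finset.Icc 1 (b - 1), (q : ℤ) ^ (b - j - 1) * fB q b j (List.ofFn x)
        + ∑ i ∈ Finset.range (m - b), (gB q b i (List.ofFn x) : ℤ) := by
  have hcard : ∀ p ∈ Finset.range m, ∀ s ∈ Finset.Ico p m,
      ((leftSet m b (extendZero x) p s ∩ rightSet m b (extendZero x) p s).card : ℤ) =
        if s < p + b then
          (q : ℤ) ^ (b - (s - p) - 1) *
            if extendZero x p ≠ extendZero x (p + b) ∧
              extendZero x s ≠ extendZero x (s + b) then 1 else 0
        else
          if extendZero x p ≠ extendZero x (p + b) ∧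
            extendZero x s ≠ extendZero x (s + b) then
            if ∀ t ∈ Finset.Icc p (s - b), extendZero x t = extendZero x (t + 2 * b) then 1
            else 0
          else 0 := by
    intro p _ s hs
    rw [Finset.mem_Ico] at hs
    rw [card_leftSet_inter_rightSet m b _ hb hs.1 hs.2, Nat.sub_right_comm b 1]
    split_ifs <;> simp
  rw [Finset.sum_congr rfl fun p hp => Finset.sum_congr rfl (hcard p hp),
    sum_range_sum_Ico_split, ← Finset.sum_congr rfl fun i hi =>
      gB_ofFn (Finset.mem_range.1 hi) x]
  have hF : ∀ j ∈ Finset.range b, (∑ p ∈ Finset.range (m - j),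
      (q : ℤ) ^ (b - (p + j - p) - 1) *
        if extendZero x p ≠ extendZero x (p + b) ∧
          extendZero x (p + j) ≠ extendZero x (p + j + b) then 1 else 0) =
      (q : ℤ) ^ (b - j - 1) * fB q b j (List.ofFn x) := by
    intro j _
    simp only [Nat.add_sub_cancel_left]
    rw [← Finset.mul_sum, fB_ofFn]
  rw [Finset.sum_congr rfl hF, Finset.range_eq_Ico, Finset.sum_eq_sum_Ico_succ_bot (by omega)]
  have hIco : Finset.Ico (0 + 1) b = Finset.Icc 1 (b - 1) := by
    ext t
    simp only [Finset.mem_Icc, Finset.mem_Ico]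
    omega
  have h0 : (fB q b 0 (List.ofFn x) : ℤ) = rB q b (List.ofFn x) - 1 := by
    simp only [fB_ofFn, rB_ofFn, Nat.sub_zero, Nat.add_zero, and_self, add_sub_cancel_left]
  rw [hIco, h0, Nat.sub_zero]

theorem sum_card_leftSet_add_card_rightSet {m b : ℕ} (hb : 1 ≤ b) (x : Fin (m + b) → Fin q) :
    (∑ p ∈ Finset.range m, ∑ s ∈ Finset.Ico p m,
      (((leftSet m b (extendZero x) p s).card : ℤ) +
        (rightSet m b (extendZero x) p s).card)) =
      (m + 1) * ((q : ℤ) ^ (b - 1) * (q - 1)) * (rB q b (List.ofFn x) - 1) := by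
  have hq : ((q - 1 : ℕ) : ℤ) = q - 1 := by
    have := NeZero.one_le (n := q)
    push_cast [this]
    rfl
  have hcard : ∀ p ∈ Finset.range m, ∀ s ∈ Finset.Ico p m,
      ((leftSet m b (extendZero x) p s).card : ℤ) + (rightSet m b (extendZero x) p s).card =
        ((q : ℤ) ^ (b - 1) * (q - 1)) *
          ((if extendZero x p ≠ extendZero x (p + b) then 1 else 0) +
            if extendZero x s ≠ extendZero x (s + b) then 1 else 0) := by
    intro p _ s hs
    rw [Finset.mem_Ico] at hs
    rw [card_leftSet m b _ hb hs.1 hs.2, card_rightSet m b _ hb hs.1 hs.2, ← hq]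
    split_ifs <;> push_cast <;> ring
  rw [Finset.sum_congr rfl fun p hp => Finset.sum_congr rfl (hcard p hp)]
  simp only [← Finset.mul_sum]
  rw [sum_range_sum_Ico_add m fun p => if extendZero x p ≠ extendZero x (p + b) then 1 else 0,
    rB_ofFn]
  ring

end Statistics

/-- exact size of the fixed-length `b`-burst Levenshtein ball of radius one. -/
theorem levBall_card_explicit (q b n : ℕ) (hq : 2 ≤ q) (hb : 1 ≤ b) (hn : 2 * b + 1 ≤ n)
    (x : List (Fin q)) (hx : x.length = n) :
    ((levBall q b 1 x).ncard : ℤ) =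
      (q : ℤ) ^ (b - 1) * (((n : ℤ) - b + 1) * ((q : ℤ) - 1) - 1) * rB q b x
        + 2 * (q : ℤ) ^ (b - 1)
        - ∑ j ∈ Finset.Icc 1 (b - 1), (q : ℤ) ^ (b - j - 1) * fB q b j x
        - ∑ i ∈ Finset.range (n - 2 * b), (gB q b i x : ℤ) := by
  classical
  have : NeZero q := ⟨by omega⟩
  obtain ⟨m, rfl⟩ : ∃ m, n = m + b := ⟨n - b, by omega⟩
  obtain ⟨y, rfl⟩ : ∃ y : Fin (m + b) → Fin q, List.ofFn y = x :=
    ⟨fun t => x[t]'(by omega), List.ext_getElem (by simp [hx]) (by simp)⟩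
  have hcast : ((q - 1 : ℕ) : ℤ) = q - 1 := by
    push_cast [show 1 ≤ q by omega]
    rfl
  have hunion : (∑ p ∈ Finset.range m, ∑ s ∈ Finset.Ico p m,
      ((leftSet m b (extendZero y) p s ∪ rightSet m b (extendZero y) p s).card : ℤ)) =
      (∑ p ∈ Finset.range m, ∑ s ∈ Finset.Ico p m,
        (((leftSet m b (extendZero y) p s).card : ℤ) +
          (rightSet m b (extendZero y) p s).card)) -
      ∑ p ∈ Finset.range m, ∑ s ∈ Finset.Ico p m,
        ((leftSet m b (extendZero y) p s ∩ rightSet m b (extendZero y) p s).card : ℤ) := by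
    simp only [← Finset.sum_sub_distrib]
    refine Finset.sum_congr rfl fun p _ => Finset.sum_congr rfl fun s _ => ?_
    rw [eq_sub_iff_add_eq]
    exact_mod_cast Finset.card_union_add_card_inter _ _
  rw [ncard_levBall_one, card_filter_shareBurstDel m b _ hb]
  push_cast
  rw [hunion, sum_card_leftSet_add_card_rightSet hb, sum_card_leftSet_inter_rightSet hb, hcast,
    show m + b - 2 * b = m - b by omega]
  ring
end

section
/- Let q ≥ 2, b ≥ 2 and n ≥ 2b+1, and for x ∈ Σ_q^n define h(x) = q^{b−1}((n−b+1)(q−1)−1)·r_b(x) + 2q^{b−1} − Σ_{j=1}^{b−1} q^{b−j−1} f_{b,j}(x). Set h* = q^{b−1}(n−b+1)((n−b+1)(q−1)−1) + 2q^{b−1} − (n−b)(q^{b−1}−1)/(q−1) + (q^b − q − (b−1)(q−1))/(q−1)^2. Then h(x) ≤ h* for every x ∈ Σ_q^n, with equality if and only if r_b(x) = n−b+1. -/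
/-- The auxiliary quantity
`h(x) = q^{b-1}((n-b+1)(q-1)-1) r_b(x) + 2 q^{b-1} - Σ_{j=1}^{b-1} q^{b-j-1} f_{b,j}(x)`
as a rational number. -/
def hAuxQ (q b n : ℕ) (x : List (Fin q)) : ℚ :=
  (q : ℚ) ^ (b - 1) * (((n : ℚ) - b + 1) * ((q : ℚ) - 1) - 1) * rB q b x
    + 2 * (q : ℚ) ^ (b - 1)
    - ∑ j ∈ Finset.Icc 1 (b - 1), (q : ℚ) ^ (b - j - 1) * fB q b j x

/-- The weighted sum `∑ q^(c-j) (m-j)` in closed form. -/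
theorem sum_pow_mul_sub_eq (q m : ℚ) (hq : q ≠ 1) (c : ℕ) :
    ∑ j ∈ Finset.Icc 1 c, q ^ (c - j) * (m - j) =
      m * (q ^ c - 1) / (q - 1) - (q ^ (c + 1) - q - c * (q - 1)) / (q - 1) ^ 2 := by
  have hq' : q - 1 ≠ 0 := sub_ne_zero.mpr hq
  induction c with
  | zero => simp
  | succ c ih =>
    rw [Finset.sum_Icc_succ_top (by omega)]
    have h : ∑ j ∈ Finset.Icc 1 c, q ^ (c + 1 - j) * (m - j) =
        q * ∑ j ∈ Finset.Icc 1 c, q ^ (c - j) * (m - j) := by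
      rw [Finset.mul_sum]
      refine Finset.sum_congr rfl fun j hj => ?_
      rw [Nat.succ_sub (Finset.mem_Icc.mp hj).2, pow_succ]
      ring
    rw [h, ih]
    push_cast
    simp only [Nat.sub_self, pow_zero]
    field_simp
    ring

/-- The geometric sum `∑ q^(c-j)` is less than `q^c`. -/
theorem sum_pow_sub_lt (q : ℚ) (hq : 2 ≤ q) (c : ℕ) :
    ∑ j ∈ Finset.Icc 1 c, q ^ (c - j) < q ^ c := by
  have h : ∑ j ∈ Finset.Icc 1 c, q ^ (c - j) = ∑ i ∈ Finset.range c, q ^ i := by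
    rw [← Finset.sum_range_reflect, ← Finset.Ico_add_one_right_eq_Icc,
      Finset.sum_Ico_eq_sum_range]
    refine Finset.sum_congr (by simp) fun i _ => ?_
    congr 1
    omega
  have hg := geom_sum_mul q c
  have hs : 0 ≤ ∑ i ∈ Finset.range c, q ^ i :=
    Finset.sum_nonneg fun i _ => by positivity
  rw [h]
  nlinarith

/-- Each index at which `P` fails spoils at most two of the pairs `(i, i + j)`. -/
theorem sub_le_card_filter_pair (P : ℕ → Prop) [DecidablePred P] (m j : ℕ) :
    m - j ≤ ((Finset.range (m - j)).filter fun i => P i ∧ P (i + j)).card +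
      2 * (m - ((Finset.range m).filter P).card) := by
  have h₀ := Finset.card_filter_add_card_filter_not (s := Finset.range m) P
  have h₁ := Finset.card_filter_add_card_filter_not (s := Finset.range (m - j))
    fun i => P i ∧ P (i + j)
  rw [Finset.card_range] at h₀ h₁
  have h₂ : ((Finset.range (m - j)).filter fun i => ¬(P i ∧ P (i + j))) ⊆
      ((Finset.range (m - j)).filter fun i => ¬P i) ∪
        ((Finset.range (m - j)).filter fun i => ¬P (i + j)) := by
    intro i hi
    simp only [Finset.mem_union, Finset.mem_filter] at hi ⊢
    tauto
  have h₃ : ((Finset.range (m - j)).filter fun i => ¬P i).card ≤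
      ((Finset.range m).filter fun i => ¬P i).card :=
    Finset.card_le_card (Finset.filter_subset_filter _ (Finset.range_mono (Nat.sub_le m j)))
  have h₄ : ((Finset.range (m - j)).filter fun i => ¬P (i + j)).card ≤
      ((Finset.range m).filter fun i => ¬P i).card := by
    refine Finset.card_le_card_of_injOn (· + j) (fun i hi => ?_) (add_left_injective j).injOn
    simp only [Finset.coe_filter, Finset.mem_range, Set.mem_ofPred_eq] at hi ⊢
    exact ⟨by omega, hi.2⟩
  have h₅ := (Finset.card_le_card h₂).trans (Finset.card_union_le _ _)
  omega

/-- `fB` loses at most `2` from its maximal value for each index with `x_i = x_{i+b}`. -/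
theorem sub_le_fB_add (q b j : ℕ) (x : List (Fin q)) :
    x.length - b - j ≤ fB q b j x + 2 * (x.length - b + 1 - rB q b x) := by
  have h := sub_le_card_filter_pair (fun i => x[i]? ≠ x[i + b]?) (x.length - b) j
  unfold fB rB
  omega

theorem rB_le (q b : ℕ) (x : List (Fin q)) : rB q b x ≤ x.length - b + 1 := by
  have h := Finset.card_filter_le (Finset.range (x.length - b)) fun i => x[i]? ≠ x[i + b]?
  rw [Finset.card_range] at h
  unfold rB
  omega

theorem fB_le (q b j : ℕ) (x : List (Fin q)) : fB q b j x ≤ x.length - b - j :=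
  (Finset.card_filter_le _ _).trans_eq (Finset.card_range _)

/-- maximum of `h` over `Σ_q^n`, attained exactly when
`r_b(x) = n - b + 1`. -/
theorem hAuxQ_le_max (q b n : ℕ) (hq : 2 ≤ q) (hb : 2 ≤ b) (hn : 2 * b + 1 ≤ n)
    (x : List (Fin q)) (hx : x.length = n) :
    hAuxQ q b n x ≤
        (q : ℚ) ^ (b - 1) * ((n : ℚ) - b + 1) * (((n : ℚ) - b + 1) * ((q : ℚ) - 1) - 1)
          + 2 * (q : ℚ) ^ (b - 1)
          - ((n : ℚ) - b) * ((q : ℚ) ^ (b - 1) - 1) / ((q : ℚ) - 1)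
          + ((q : ℚ) ^ b - q - ((b : ℚ) - 1) * ((q : ℚ) - 1)) / ((q : ℚ) - 1) ^ 2 ∧
      (hAuxQ q b n x =
          (q : ℚ) ^ (b - 1) * ((n : ℚ) - b + 1) * (((n : ℚ) - b + 1) * ((q : ℚ) - 1) - 1)
            + 2 * (q : ℚ) ^ (b - 1)
            - ((n : ℚ) - b) * ((q : ℚ) ^ (b - 1) - 1) / ((q : ℚ) - 1)
            + ((q : ℚ) ^ b - q - ((b : ℚ) - 1) * ((q : ℚ) - 1)) / ((q : ℚ) - 1) ^ 2 ↔
        rB q b x = n - b + 1) := by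
  obtain ⟨c, rfl⟩ : ∃ c, b = c + 1 := ⟨b - 1, by omega⟩
  obtain ⟨m, rfl⟩ : ∃ m, n = m + (c + 1) := ⟨n - (c + 1), by omega⟩
  obtain ⟨d, hd⟩ : ∃ d, rB q (c + 1) x + d = m + 1 := by
    have h := rB_le q (c + 1) x
    exact ⟨m + 1 - rB q (c + 1) x, by omega⟩
  have hq₂ : (2 : ℚ) ≤ q := by exact_mod_cast hq
  have hm : (3 : ℚ) ≤ m := by exact_mod_cast (by omega : 3 ≤ m)
  have hr : (rB q (c + 1) x : ℚ) = m + 1 - d := by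
    rw [eq_sub_iff_add_eq]
    exact_mod_cast hd
  have hclosed := sum_pow_mul_sub_eq (q : ℚ) m (by linarith) c
  have hgeom := sum_pow_sub_lt (q : ℚ) hq₂ c
  set S := ∑ j ∈ Finset.Icc 1 c, (q : ℚ) ^ (c - j)
  have hS : ∑ j ∈ Finset.Icc 1 c, (q : ℚ) ^ (c - j) * (m - j) - 2 * d * S ≤
      ∑ j ∈ Finset.Icc 1 c, (q : ℚ) ^ (c - j) * fB q (c + 1) j x := by
    rw [Finset.mul_sum, ← Finset.sum_sub_distrib]
    refine Finset.sum_le_sum fun j _ => ?_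
    have hf := sub_le_fB_add q (c + 1) j x
    have hf' : (m : ℚ) ≤ fB q (c + 1) j x + 2 * d + j := by
      exact_mod_cast (by omega : m ≤ fB q (c + 1) j x + 2 * d + j)
    have hp : (0 : ℚ) ≤ (q : ℚ) ^ (c - j) := by positivity
    nlinarith
  have hF : d = 0 → ∑ j ∈ Finset.Icc 1 c, (q : ℚ) ^ (c - j) * fB q (c + 1) j x =
      ∑ j ∈ Finset.Icc 1 c, (q : ℚ) ^ (c - j) * (m - j) := by
    intro h₀
    refine Finset.sum_congr rfl fun j hj => ?_
    have hj' := (Finset.mem_Icc.mp hj).2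
    have hf : fB q (c + 1) j x + j = m := by
      have h₁ := sub_le_fB_add q (c + 1) j x
      have h₂ := fB_le q (c + 1) j x
      omega
    rw [← hf]
    push_cast
    ring
  have hQ : (0 : ℚ) < (q : ℚ) ^ c := by positivity
  have hgap : 2 * S < (q : ℚ) ^ c * (((m : ℚ) + 1) * ((q : ℚ) - 1) - 1) := by
    have h : (2 : ℚ) ≤ ((m : ℚ) + 1) * ((q : ℚ) - 1) - 1 := by nlinarith
    nlinarith
  have hval : hAuxQ q (c + 1) (m + (c + 1)) x =
      (q : ℚ) ^ c * (((m : ℚ) + 1) * ((q : ℚ) - 1) - 1) * (m + 1 - d) + 2 * (q : ℚ) ^ c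
        - ∑ j ∈ Finset.Icc 1 c, (q : ℚ) ^ (c - j) * fB q (c + 1) j x := by
    unfold hAuxQ
    rw [hr]
    have he : ∀ j, c + 1 - j - 1 = c - j := fun j => by omega
    simp only [he, Nat.add_sub_cancel]
    push_cast
    ring
  have hmax : (q : ℚ) ^ (c + 1 - 1) * (((m + (c + 1) : ℕ) : ℚ) - (c + 1 : ℕ) + 1) *
        ((((m + (c + 1) : ℕ) : ℚ) - (c + 1 : ℕ) + 1) * ((q : ℚ) - 1) - 1)
      + 2 * (q : ℚ) ^ (c + 1 - 1)
      - (((m + (c + 1) : ℕ) : ℚ) - (c + 1 : ℕ)) * ((q : ℚ) ^ (c + 1 - 1) - 1) / ((q : ℚ) - 1)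
      + ((q : ℚ) ^ (c + 1) - q - (((c + 1 : ℕ) : ℚ) - 1) * ((q : ℚ) - 1)) / ((q : ℚ) - 1) ^ 2 =
      (q : ℚ) ^ c * (((m : ℚ) + 1) * ((q : ℚ) - 1) - 1) * (m + 1) + 2 * (q : ℚ) ^ c
        - ∑ j ∈ Finset.Icc 1 c, (q : ℚ) ^ (c - j) * (m - j) := by
    rw [hclosed]
    simp only [Nat.add_sub_cancel]
    push_cast
    ring
  rw [hmax, hval]
  have hd₀ : (0 : ℚ) ≤ d := d.cast_nonneg
  refine ⟨by nlinarith, fun h => ?_, fun h => ?_⟩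
  · have hzero : d = 0 := by
      by_contra hne
      have hpos : (0 : ℚ) < d := by exact_mod_cast Nat.pos_of_ne_zero hne
      nlinarith
    omega
  · have hzero : d = 0 := by omega
    rw [hF hzero, hzero]
    simp
end
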